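/- The set {i ∈ ℕ : E_i is computably equivalent to the word problem of some finitely generated recursively presented group} is Σ⁰₃-complete: it is Σ⁰₃ and every Σ⁰₃ subset of ℕ many-one reduces to it. -/

import Mathlib

/-- The `e`-th computably enumerable subset of `ℕ`: the domain of the `e`-th partial
computable function. -/
def W (e : ℕ) : Set ℕ := {n | ((Denumerable.ofNat Nat.Partrec.Code e).eval n).Dom}

/-- A set `S ⊆ ℕ` is Σ⁰₃ if there is a computable predicate `R ⊆ ℕ⁴` with
`n ∈ S ↔ ∃x ∀y ∃z, R n x y z`. -/
def IsSigma03 (S : Set ℕ) : Prop :=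
  ∃ R : ℕ → ℕ → ℕ → ℕ → Bool,
    (Computable fun p : ℕ × ℕ × ℕ × ℕ => R p.1 p.2.1 p.2.2.1 p.2.2.2) ∧
    ∀ n, n ∈ S ↔ ∃ x, ∀ y, ∃ z, R n x y z = true

/-- A binary relation on `ℕ` is Σ⁰₃ if the corresponding set of codes of pairs
(under the standard computable pairing) is Σ⁰₃. -/
def Sigma03Rel (E : ℕ → ℕ → Prop) : Prop :=
  IsSigma03 {p : ℕ | E p.unpair.1 p.unpair.2}

/-- `E` computably reduces to `F`: there is a total computable `Φ` with
`m E n ↔ Φ(m) F Φ(n)`. -/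
def ComputableReduction (E F : ℕ → ℕ → Prop) : Prop :=
  ∃ Φ : ℕ → ℕ, Computable Φ ∧ ∀ m n, E m n ↔ F (Φ m) (Φ n)

/-- `E` and `F` are computably equivalent: computable reductions exist in both directions. -/
def CeerEquiv (E F : ℕ → ℕ → Prop) : Prop :=
  ComputableReduction E F ∧ ComputableReduction F E

/-- The fixed uniform enumeration of all ceers: `ceer i` is the equivalence relation
generated by the `i`-th c.e. set `W i` of coded pairs. -/
def ceer (i : ℕ) : ℕ → ℕ → Prop :=
  Relation.EqvGen fun m n => Nat.pair m n ∈ W i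

/-- `[S]`: the closure of a set of indices of ceers under computable equivalence. -/
def ceerClosure (S : Set ℕ) : Set ℕ := {i | ∃ j ∈ S, CeerEquiv (ceer i) (ceer j)}

/-- An equivalence relation on `ℕ` has infinitely many classes iff there is an infinite
family of pairwise inequivalent elements. -/
def HasInfinitelyManyClasses (E : ℕ → ℕ → Prop) : Prop :=
  ∃ f : ℕ → ℕ, ∀ m n, m ≠ n → ¬E (f m) (f n)

/-- `S` is proper on the infinite ceers: some ceer with infinitely many classes has its
index in `[S]` and some ceer with infinitely many classes has its index outside `[S]`. -/
def ProperOnInfiniteCeers (S : Set ℕ) : Prop :=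
  ∃ i j, HasInfinitelyManyClasses (ceer i) ∧ HasInfinitelyManyClasses (ceer j) ∧
    i ∈ ceerClosure S ∧ j ∉ ceerClosure S

/-- Code of an element of the free group on `Fin k`, via its reduced word. -/
def encodeFG {k : ℕ} (g : FreeGroup (Fin k)) : ℕ := Encodable.encode g.toWord

/-- The relator set of the `e`-th c.e. presentation on `k` generators: the set of elements
of the free group on `k` generators whose codes lie in `W e`.  The presented group
`⟨x₁,…,x_k ∣ relSet k e⟩` is `PresentedGroup (relSet k e)`, the quotient of the free group
by the normal closure of this set. -/
def relSet (k e : ℕ) : Set (FreeGroup (Fin k)) := {g | encodeFG g ∈ W e}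

/-- Decode a natural number as an element of the free group on `k` generators
(codes of words; non-codes decode to the empty word). -/
def decodeWord (k : ℕ) (m : ℕ) : FreeGroup (Fin k) :=
  FreeGroup.mk ((Encodable.decode (α := List (Fin k × Bool)) m).getD [])

/-- The word problem of the group `⟨x₁,…,x_k ∣ R⟩`: the equivalence relation on `ℕ`
identifying codes of words whose images in the presented group coincide. -/
def wordProblem (k : ℕ) (R : Set (FreeGroup (Fin k))) : ℕ → ℕ → Prop := fun m n =>
  PresentedGroup.mk R (decodeWord k m) = PresentedGroup.mk R (decodeWord k n)

/-- The set of indices `i` such that `E_i` is computably equivalent to the word problem of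
some finitely generated recursively presented group `⟨x₁,…,x_k ∣ R_e⟩`. -/
def FGWordProblemIndices : Set ℕ :=
  {i | ∃ k e : ℕ, CeerEquiv (ceer i) (wordProblem k (relSet k e))}

open Encodable
open Nat.Partrec (Code)

/-- `P` is the projection of a primitive recursive relation. -/
def PrimrecProj {α : Type*} [Primcodable α] (P : α → Prop) : Prop :=
  ∃ r : α → ℕ → Prop, PrimrecRel r ∧ ∀ a, P a ↔ ∃ s, r a s

namespace PrimrecProj

variable {α β : Type} [Primcodable α] [Primcodable β]

theorem of_eq {P Q : α → Prop} (hP : PrimrecProj P) (h : ∀ a, P a ↔ Q a) : PrimrecProj Q :=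
  (funext fun a => propext (h a) : P = Q) ▸ hP

theorem of_primrecPred {P : α → Prop} (hP : PrimrecPred P) : PrimrecProj P :=
  ⟨fun a _ => P a, hP.comp Primrec.fst, fun a => by simp⟩

theorem comp {P : β → Prop} (hP : PrimrecProj P) {f : α → β} (hf : Primrec f) :
    PrimrecProj fun a => P (f a) := by
  obtain ⟨r, hr, h⟩ := hP
  exact ⟨fun a s => r (f a) s, hr.comp (hf.comp Primrec.fst) Primrec.snd, fun a => h (f a)⟩

theorem exists_mem {P : α → β → Prop} (hP : PrimrecProj fun p : α × β => P p.1 p.2) :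
    PrimrecProj fun a => ∃ b, P a b := by
  obtain ⟨r, hr, h⟩ := hP
  refine ⟨fun a s => ∃ b ∈ (decode (α := β) s.unpair.1).toList, r (a, b) s.unpair.2, ?_, ?_⟩
  · have h1 : PrimrecRel fun (b : β) (q : α × ℕ) => r (q.1, b) q.2.unpair.2 :=
      hr.comp ((Primrec.fst.comp Primrec.snd).pair Primrec.fst)
        (Primrec.snd.comp (Primrec.unpair.comp (Primrec.snd.comp Primrec.snd)))
    exact h1.exists_mem_list.comp (Primrec.optionToList.comp
      (Primrec.decode.comp (Primrec.fst.comp (Primrec.unpair.comp Primrec.snd)))) Primrec.id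
  · intro a
    constructor
    · rintro ⟨b, hb⟩
      obtain ⟨s, hs⟩ := (h (a, b)).1 hb
      exact ⟨Nat.pair (encode b) s, b, by simp, by simpa using hs⟩
    · rintro ⟨s, b, -, hb⟩
      exact ⟨b, (h (a, b)).2 ⟨_, hb⟩⟩

theorem and {P Q : α → Prop} (hP : PrimrecProj P) (hQ : PrimrecProj Q) :
    PrimrecProj fun a => P a ∧ Q a := by
  obtain ⟨r, hr, h⟩ := hP
  obtain ⟨r', hr', h'⟩ := hQ
  have hu := Primrec.unpair.comp (Primrec.snd (α := α) (β := ℕ))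
  refine ⟨fun a s => r a s.unpair.1 ∧ r' a s.unpair.2,
    (hr.comp Primrec.fst (Primrec.fst.comp hu)).and (hr'.comp Primrec.fst (Primrec.snd.comp hu)),
    fun a => ?_⟩
  constructor
  · rintro ⟨hp, hq⟩
    obtain ⟨s, hs⟩ := (h a).1 hp
    obtain ⟨t, ht⟩ := (h' a).1 hq
    exact ⟨Nat.pair s t, by simpa using ⟨hs, ht⟩⟩
  · rintro ⟨s, hs⟩
    exact ⟨(h a).2 ⟨_, hs.1⟩, (h' a).2 ⟨_, hs.2⟩⟩

theorem or {P Q : α → Prop} (hP : PrimrecProj P) (hQ : PrimrecProj Q) :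
    PrimrecProj fun a => P a ∨ Q a := by
  obtain ⟨r, hr, h⟩ := hP
  obtain ⟨r', hr', h'⟩ := hQ
  exact ⟨fun a s => r a s ∨ r' a s, hr.or hr', fun a => by simp only [h, h', exists_or]⟩

theorem forall_lt {P : α → ℕ → Prop} (hP : PrimrecProj fun p : α × ℕ => P p.1 p.2)
    {f : α → ℕ} (hf : Primrec f) : PrimrecProj fun a => ∀ y < f a, P a y := by
  obtain ⟨r, hr, h⟩ := hP
  have h1 : PrimrecRel fun (y : ℕ) (q : α × List ℕ) => r (q.1, y) (q.2.getD y 0) :=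
    hr.comp ((Primrec.fst.comp Primrec.snd).pair Primrec.fst)
      ((Primrec.list_getD 0).comp (Primrec.snd.comp Primrec.snd) Primrec.fst)
  have h2 : PrimrecPred fun q : α × List ℕ =>
      ∀ y ∈ List.range (f q.1), r (q.1, y) (q.2.getD y 0) :=
    h1.forall_mem_list.comp (Primrec.list_range.comp (hf.comp Primrec.fst)) Primrec.id
  refine (exists_mem (P := fun a (l : List ℕ) => ∀ y < f a, r (a, y) (l.getD y 0))
    (of_primrecPred (h2.of_eq fun _ => by simp))).of_eq fun a => ?_
  constructor
  · rintro ⟨l, hl⟩ y hy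
    exact (h (a, y)).2 ⟨_, hl y hy⟩
  · intro H
    choose! w hw using fun y hy => (h (a, y)).1 (H y hy)
    refine ⟨(List.range (f a)).map w, fun y hy => ?_⟩
    simpa [hy] using hw y hy

end PrimrecProj

theorem mem_W_iff {e n : ℕ} :
    n ∈ W e ↔ ∃ s, (Code.evaln s (Denumerable.ofNat Code e) n).isSome = true := by
  simp only [W, Set.mem_ofPred_eq, Part.dom_iff_mem, Code.evaln_complete, Option.isSome_iff_exists,
    Option.mem_def]
  exact exists_comm

theorem primrec_evaln_ofNat : Primrec fun a : (ℕ × ℕ) × ℕ =>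
    Code.evaln a.1.1 (Denumerable.ofNat Code a.1.2) a.2 :=
  Code.primrec_evaln.comp (((Primrec.fst.comp Primrec.fst).pair
    ((Primrec.ofNat Code).comp (Primrec.snd.comp Primrec.fst))).pair Primrec.snd)

theorem primrecPred_isSome {α β : Type*} [Primcodable α] [Primcodable β] {f : α → Option β}
    (hf : Primrec f) : PrimrecPred fun a => (f a).isSome = true :=
  Primrec.eq.comp (Primrec.option_isSome.comp hf) (Primrec.const true)

theorem primrecProj_W : PrimrecProj fun p : ℕ × ℕ => p.2 ∈ W p.1 :=
  ⟨fun p s => (Code.evaln s (Denumerable.ofNat Code p.1) p.2).isSome = true,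
    primrecPred_isSome (primrec_evaln_ofNat.comp
      ((Primrec.snd.pair (Primrec.fst.comp Primrec.fst)).pair (Primrec.snd.comp Primrec.fst))),
    fun _ => mem_W_iff⟩

/-- The `s-m-n` theorem for projections of primitive recursive relations. -/
theorem PrimrecProj.exists_index {P : ℕ → ℕ → Prop} (hP : PrimrecProj fun p : ℕ × ℕ => P p.1 p.2) :
    ∃ f : ℕ → ℕ, Primrec f ∧ ∀ n m, m ∈ W (f n) ↔ P n m := by
  obtain ⟨r, ⟨hd, hr⟩, h⟩ := hP
  let (a : ℕ × ℕ) (s : ℕ) : Decidable (r a s) := hd (a, s)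
  have h1 : Partrec fun a : ℕ => Nat.rfind (PFun.lift fun s => decide (r a.unpair s)) :=
    Partrec.rfind (hr.comp ((Primrec.unpair.comp Primrec.fst).pair Primrec.snd)).to_comp.partrec
  obtain ⟨c, hc⟩ := Code.exists_code.1 (Partrec.nat_iff.1 h1)
  refine ⟨fun n => encode (c.curry n), Primrec.encode.comp
    (Code.primrec₂_curry.comp (Primrec.const c) Primrec.id), fun n m => ?_⟩
  have hdom : m ∈ W (encode (c.curry n)) ↔ ∃ s, r (n, m) s := by
    simp [W, Code.eval_curry, hc, Nat.rfind_dom]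
  exact hdom.trans (h (n, m)).symm

/-- Equivalence generated by a relation with primitive recursive approximations is again a
projection. -/
theorem eqvGen_iff_exists_foldl {r : ℕ → ℕ → Prop} {q : ℕ → ℕ → ℕ → Prop}
    [∀ x z s, Decidable (q x z s)] (h : ∀ m n, r m n ↔ ∃ s, q m n s) (m n : ℕ) :
    Relation.EqvGen r m n ↔ ∃ l : List (ℕ × ℕ),
      l.foldl (fun x p => if q x p.1 p.2 ∨ q p.1 x p.2 then p.1 else x) m = n := by
  set st : ℕ → ℕ × ℕ → ℕ := fun x p => if q x p.1 p.2 ∨ q p.1 x p.2 then p.1 else x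
  constructor
  · intro H
    have key : (∃ l : List (ℕ × ℕ), l.foldl st m = n) ∧ ∃ l : List (ℕ × ℕ), l.foldl st n = m := by
      induction H with
      | rel x y hxy =>
        obtain ⟨s, hs⟩ := (h x y).1 hxy
        exact ⟨⟨[(y, s)], by simp [st, hs]⟩, [(x, s)], by simp [st, hs]⟩
      | refl x => exact ⟨⟨[], rfl⟩, [], rfl⟩
      | symm x y _ ih => exact ih.symm
      | trans x y z _ _ ih₁ ih₂ =>
        obtain ⟨⟨l₁, rfl⟩, l₂, h₂⟩ := ih₁
        obtain ⟨⟨l₃, rfl⟩, l₄, h₄⟩ := ih₂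
        exact ⟨⟨l₁ ++ l₃, by simp⟩, l₄ ++ l₂, by simp [h₄, h₂]⟩
    exact key.1
  · rintro ⟨l, rfl⟩
    induction l generalizing m with
    | nil => exact .refl _
    | cons p l ih =>
      refine .trans _ (st m p) _ ?_ (ih _)
      by_cases hq : q m p.1 p.2 ∨ q p.1 m p.2
      · simp only [st, if_pos hq]
        rcases hq with hq | hq
        · exact .rel _ _ ((h _ _).2 ⟨_, hq⟩)
        · exact .symm _ _ (.rel _ _ ((h _ _).2 ⟨_, hq⟩))
      · simp only [st, if_neg hq]
        exact .refl _

theorem primrecProj_ceer : PrimrecProj fun p : ℕ × ℕ × ℕ => ceer p.1 p.2.1 p.2.2 := by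
  obtain ⟨q, hq, hqW⟩ : ∃ q : ℕ → ℕ → ℕ → ℕ → Bool,
      (Primrec fun a : ℕ × ℕ × ℕ × ℕ => q a.1 a.2.1 a.2.2.1 a.2.2.2) ∧
      ∀ i x z, Nat.pair x z ∈ W i ↔ ∃ s, q i x z s = true := by
    obtain ⟨r, ⟨hd, hr⟩, h⟩ := primrecProj_W
    refine ⟨fun i x z s => @decide _ (hd ((i, Nat.pair x z), s)),
      hr.comp ((Primrec.fst.pair (Primrec₂.natPair.comp (Primrec.fst.comp Primrec.snd)
        (Primrec.fst.comp (Primrec.snd.comp Primrec.snd)))).pair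
          (Primrec.snd.comp (Primrec.snd.comp Primrec.snd))), fun i x z => ?_⟩
    simpa using h (i, Nat.pair x z)
  let st (i x : ℕ) (p : ℕ × ℕ) : ℕ :=
    if q i x p.1 p.2 = true ∨ q i p.1 x p.2 = true then p.1 else x
  have hstep : Primrec₂ fun (a : (ℕ × ℕ × ℕ) × List (ℕ × ℕ)) (b : ℕ × ℕ × ℕ) =>
      st a.1.1 b.1 b.2 := by
    have h0 : Primrec fun c : ((ℕ × ℕ × ℕ) × List (ℕ × ℕ)) × (ℕ × ℕ × ℕ) => c.1.1.1 :=
      Primrec.fst.comp (Primrec.fst.comp Primrec.fst)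
    have h1 : Primrec fun c : ((ℕ × ℕ × ℕ) × List (ℕ × ℕ)) × (ℕ × ℕ × ℕ) => c.2.1 :=
      Primrec.fst.comp Primrec.snd
    have h3 : Primrec fun c : ((ℕ × ℕ × ℕ) × List (ℕ × ℕ)) × (ℕ × ℕ × ℕ) => c.2.2.1 :=
      Primrec.fst.comp (Primrec.snd.comp Primrec.snd)
    have h4 : Primrec fun c : ((ℕ × ℕ × ℕ) × List (ℕ × ℕ)) × (ℕ × ℕ × ℕ) => c.2.2.2 :=
      Primrec.snd.comp (Primrec.snd.comp Primrec.snd)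
    have h5 : Primrec fun c : ((ℕ × ℕ × ℕ) × List (ℕ × ℕ)) × (ℕ × ℕ × ℕ) =>
        q c.1.1.1 c.2.1 c.2.2.1 c.2.2.2 := by
      have := hq.comp (h0.pair (h1.pair (h3.pair h4)))
      exact this
    have h6 : Primrec fun c : ((ℕ × ℕ × ℕ) × List (ℕ × ℕ)) × (ℕ × ℕ × ℕ) =>
        q c.1.1.1 c.2.2.1 c.2.1 c.2.2.2 := by
      have := hq.comp (h0.pair (h3.pair (h1.pair h4)))
      exact this
    have h7 : PrimrecPred fun c : ((ℕ × ℕ × ℕ) × List (ℕ × ℕ)) × (ℕ × ℕ × ℕ) =>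
        q c.1.1.1 c.2.1 c.2.2.1 c.2.2.2 = true ∨ q c.1.1.1 c.2.2.1 c.2.1 c.2.2.2 = true :=
      (Primrec.eq.comp h5 (Primrec.const true)).or (Primrec.eq.comp h6 (Primrec.const true))
    exact Primrec.ite h7 h3 h1
  have hfold : Primrec fun a : (ℕ × ℕ × ℕ) × List (ℕ × ℕ) => a.2.foldl (st a.1.1) a.1.2.1 :=
    Primrec.list_foldl Primrec.snd (Primrec.fst.comp (Primrec.snd.comp Primrec.fst)) hstep
  have hpred : PrimrecPred fun a : (ℕ × ℕ × ℕ) × List (ℕ × ℕ) =>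
      a.2.foldl (st a.1.1) a.1.2.1 = a.1.2.2 :=
    Primrec.eq.comp hfold (Primrec.snd.comp (Primrec.snd.comp Primrec.fst))
  refine (PrimrecProj.exists_mem (P := fun (a : ℕ × ℕ × ℕ) (l : List (ℕ × ℕ)) =>
    l.foldl (st a.1) a.2.1 = a.2.2) (.of_primrecPred hpred)).of_eq fun a => ?_
  exact (eqvGen_iff_exists_foldl (q := fun x z s => q a.1 x z s = true) (hqW a.1) _ _).symm

theorem Computable.primrecProj {α : Type} [Primcodable α] {f : α → Bool} (hf : Computable f) :
    PrimrecProj fun a => f a = true := by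
  obtain ⟨c, hc⟩ := Code.exists_code.1 hf
  refine (PrimrecProj.exists_mem (P := fun a s => Code.evaln s c (encode a) = some (encode true))
    (.of_primrecPred (Primrec.eq.comp (Code.primrec_evaln.comp
      ((Primrec.snd.pair (Primrec.const c)).pair (Primrec.encode.comp Primrec.fst)))
      (Primrec.const _)))).of_eq fun a => ?_
  simp only [← Option.mem_def]
  rw [← Code.evaln_complete, hc]
  cases h : f a <;> simp [h]

theorem isSigma03_iff {S : Set ℕ} : IsSigma03 S ↔ ∃ P : ℕ → ℕ → ℕ → Prop,
    (PrimrecProj fun p : ℕ × ℕ × ℕ => P p.1 p.2.1 p.2.2) ∧ ∀ n, n ∈ S ↔ ∃ x, ∀ y, P n x y := by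
  constructor
  · rintro ⟨R, hR, h⟩
    refine ⟨fun n x y => ∃ z, R n x y z = true, PrimrecProj.exists_mem ?_, h⟩
    exact hR.primrecProj.comp (f := fun a : (ℕ × ℕ × ℕ) × ℕ => (a.1.1, a.1.2.1, a.1.2.2, a.2))
      ((Primrec.fst.comp Primrec.fst).pair ((Primrec.fst.comp (Primrec.snd.comp Primrec.fst)).pair
        ((Primrec.snd.comp (Primrec.snd.comp Primrec.fst)).pair Primrec.snd)))
  · rintro ⟨P, ⟨r, ⟨hd, hr⟩, h⟩, hP⟩
    refine ⟨fun n x y z => @decide _ (hd ((n, x, y), z)), ?_, fun n => ?_⟩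
    · exact (hr.comp ((Primrec.fst.pair ((Primrec.fst.comp Primrec.snd).pair
        (Primrec.fst.comp (Primrec.snd.comp Primrec.snd)))).pair
          (Primrec.snd.comp (Primrec.snd.comp Primrec.snd)))).to_comp
    · simp only [hP, fun x y => h (n, x, y), decide_eq_true_eq]

theorem exists_code_eval_eq {f : ℕ → ℕ} :
    Computable f ↔ ∃ a, ∀ m, f m ∈ (Denumerable.ofNat Code a).eval m := by
  constructor
  · intro hf
    obtain ⟨c, hc⟩ := Code.exists_code.1 (Partrec.nat_iff.1 hf)
    exact ⟨encode c, fun m => by simp [hc]⟩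
  · rintro ⟨a, ha⟩
    refine Partrec.nat_iff.2 (Code.exists_code.2 ⟨Denumerable.ofNat Code a, funext fun m => ?_⟩)
    exact Part.eq_some_iff.2 (ha m)

/-- Computable reducibility between ceers has the quantifier form `∃ ∀ ∃`. -/
theorem computableReduction_ceer_iff : ∃ P : ℕ × ℕ → ℕ → ℕ → Prop,
    (PrimrecProj fun p : (ℕ × ℕ) × ℕ × ℕ => P p.1 p.2.1 p.2.2) ∧
    ∀ i j, ComputableReduction (ceer i) (ceer j) ↔ ∃ a, ∀ y, P (i, j) a y := by
  obtain ⟨C, hC, h⟩ := primrecProj_ceer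
  let y₁ (y : ℕ) := y.unpair.1
  let y₂ (y : ℕ) := y.unpair.2.unpair.1
  let y₃ (y : ℕ) := y.unpair.2.unpair.2
  have hy₁ : Primrec y₁ := Primrec.fst.comp Primrec.unpair
  have hy₂ : Primrec y₂ :=
    Primrec.fst.comp (Primrec.unpair.comp (Primrec.snd.comp Primrec.unpair))
  have hy₃ : Primrec y₃ :=
    Primrec.snd.comp (Primrec.unpair.comp (Primrec.snd.comp Primrec.unpair))
  let ev (s a m : ℕ) : Option ℕ := Code.evaln s (Denumerable.ofNat Code a) m
  let Q (p : ((ℕ × ℕ) × ℕ × ℕ)) (w : ℕ × ℕ × ℕ) : Prop :=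
    (ev w.1 p.2.1 (y₁ p.2.2) = some w.2.1 ∧ ev w.1 p.2.1 (y₂ p.2.2) = some w.2.2) ∧
    (¬ C (p.1.1, y₁ p.2.2, y₂ p.2.2) (y₃ p.2.2) ∨ ceer p.1.2 w.2.1 w.2.2) ∧
    (¬ C (p.1.2, w.2.1, w.2.2) (y₃ p.2.2) ∨ ceer p.1.1 (y₁ p.2.2) (y₂ p.2.2))
  refine ⟨fun p a y => ∃ w, Q (p, a, y) w, PrimrecProj.exists_mem ?_, fun i j => ?_⟩
  · have hi : Primrec fun q : ((ℕ × ℕ) × ℕ × ℕ) × (ℕ × ℕ × ℕ) => q.1.1.1 :=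
      Primrec.fst.comp (Primrec.fst.comp Primrec.fst)
    have hj : Primrec fun q : ((ℕ × ℕ) × ℕ × ℕ) × (ℕ × ℕ × ℕ) => q.1.1.2 :=
      Primrec.snd.comp (Primrec.fst.comp Primrec.fst)
    have ha : Primrec fun q : ((ℕ × ℕ) × ℕ × ℕ) × (ℕ × ℕ × ℕ) => q.1.2.1 :=
      Primrec.fst.comp (Primrec.snd.comp Primrec.fst)
    have hy : Primrec fun q : ((ℕ × ℕ) × ℕ × ℕ) × (ℕ × ℕ × ℕ) => q.1.2.2 :=
      Primrec.snd.comp (Primrec.snd.comp Primrec.fst)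
    have hs : Primrec fun q : ((ℕ × ℕ) × ℕ × ℕ) × (ℕ × ℕ × ℕ) => q.2.1 :=
      Primrec.fst.comp Primrec.snd
    have hu : Primrec fun q : ((ℕ × ℕ) × ℕ × ℕ) × (ℕ × ℕ × ℕ) => q.2.2.1 :=
      Primrec.fst.comp (Primrec.snd.comp Primrec.snd)
    have hv : Primrec fun q : ((ℕ × ℕ) × ℕ × ℕ) × (ℕ × ℕ × ℕ) => q.2.2.2 :=
      Primrec.snd.comp (Primrec.snd.comp Primrec.snd)
    have hev : Primrec fun q : (ℕ × ℕ) × ℕ => ev q.1.1 q.1.2 q.2 := primrec_evaln_ofNat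
    have hm := hy₁.comp hy
    have hn := hy₂.comp hy
    have ht := hy₃.comp hy
    refine .and (.and (.of_primrecPred ?_) (.of_primrecPred ?_)) (.and (.or ?_ ?_) (.or ?_ ?_))
    · exact Primrec.eq.comp (hev.comp ((hs.pair ha).pair hm)) (Primrec.option_some.comp hu)
    · exact Primrec.eq.comp (hev.comp ((hs.pair ha).pair hn)) (Primrec.option_some.comp hv)
    · exact .of_primrecPred (hC.comp (hi.pair (hm.pair hn)) ht).not
    · exact primrecProj_ceer.comp (hj.pair (hu.pair hv))
    · exact .of_primrecPred (hC.comp (hj.pair (hu.pair hv)) ht).not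
    · exact primrecProj_ceer.comp (hi.pair (hm.pair hn))
  · constructor
    · rintro ⟨Φ, hΦ, hred⟩
      obtain ⟨a, ha⟩ := exists_code_eval_eq.1 hΦ
      refine ⟨a, fun y => ?_⟩
      obtain ⟨s, hs⟩ := Code.evaln_complete.1 (ha (y₁ y))
      obtain ⟨t, ht⟩ := Code.evaln_complete.1 (ha (y₂ y))
      refine ⟨(max s t, Φ (y₁ y), Φ (y₂ y)), ⟨Code.evaln_mono (le_max_left _ _) hs,
        Code.evaln_mono (le_max_right _ _) ht⟩, ?_, ?_⟩
      · exact not_or_of_imp fun hc => (hred _ _).1 ((h _).2 ⟨_, hc⟩)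
      · exact not_or_of_imp fun hc => (hred _ _).2 ((h _).2 ⟨_, hc⟩)
    · rintro ⟨a, ha⟩
      have hval : ∀ m, ∃ u, u ∈ (Denumerable.ofNat Code a).eval m := fun m => by
        obtain ⟨w, ⟨hw, -⟩, -⟩ := ha (Nat.pair m 0)
        simp only [y₁, Nat.unpair_pair] at hw
        exact ⟨_, Code.evaln_sound hw⟩
      choose Φ hΦ using hval
      refine ⟨Φ, exists_code_eval_eq.2 ⟨a, hΦ⟩, fun m n => ?_⟩
      have hex : ∀ t, (¬ C (i, m, n) t ∨ ceer j (Φ m) (Φ n)) ∧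
          (¬ C (j, Φ m, Φ n) t ∨ ceer i m n) := fun t => by
        obtain ⟨⟨s, u, v⟩, ⟨hu, hv⟩, hQ⟩ := ha (Nat.pair m (Nat.pair n t))
        simp only [y₁, y₂, y₃, Nat.unpair_pair] at hu hv hQ
        rwa [Part.mem_unique (Code.evaln_sound hu) (hΦ m),
          Part.mem_unique (Code.evaln_sound hv) (hΦ n)] at hQ
      constructor
      · intro hc
        obtain ⟨t, ht⟩ := (h (i, m, n)).1 hc
        exact (hex t).1.resolve_left (not_not_intro ht)
      · intro hc
        obtain ⟨t, ht⟩ := (h (j, Φ m, Φ n)).1 hc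
        exact (hex t).2.resolve_left (not_not_intro ht)

/-- The indices of ceers equivalent to a member of a uniformly indexed family form a `Σ⁰₃` set. -/
theorem isSigma03_ceerEquiv_range {f : ℕ → ℕ} (hf : Primrec f) :
    IsSigma03 {i | ∃ p, CeerEquiv (ceer i) (ceer (f p))} := by
  obtain ⟨P, hP, h⟩ := computableReduction_ceer_iff
  refine isSigma03_iff.2 ⟨fun i x y => P (i, f x.unpair.1) x.unpair.2.unpair.1 y ∧
    P (f x.unpair.1, i) x.unpair.2.unpair.2 y, ?_, fun i => ?_⟩
  · have hi : Primrec fun q : ℕ × ℕ × ℕ => q.1 := Primrec.fst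
    have hx : Primrec fun q : ℕ × ℕ × ℕ => q.2.1.unpair :=
      Primrec.unpair.comp (Primrec.fst.comp Primrec.snd)
    have hy : Primrec fun q : ℕ × ℕ × ℕ => q.2.2 := Primrec.snd.comp Primrec.snd
    have hj := hf.comp (Primrec.fst.comp hx)
    have hab := Primrec.unpair.comp (Primrec.snd.comp hx)
    have ha := Primrec.fst.comp hab
    have hb := Primrec.snd.comp hab
    exact .and (hP.comp ((hi.pair hj).pair (ha.pair hy))) (hP.comp ((hj.pair hi).pair (hb.pair hy)))
  · simp only [Set.mem_ofPred_eq, CeerEquiv, h]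
    constructor
    · rintro ⟨p, ⟨a, ha⟩, b, hb⟩
      exact ⟨Nat.pair p (Nat.pair a b), fun y => by simpa using ⟨ha y, hb y⟩⟩
    · rintro ⟨x, hx⟩
      exact ⟨_, ⟨_, fun y => (hx y).1⟩, _, fun y => (hx y).2⟩

open FreeGroup (invRev)

/-- Restriction of a letter to the generators with index less than `k`. -/
def toFinLetter (k : ℕ) (x : ℕ × Bool) : Option (Fin k × Bool) :=
  (decode (α := Fin k) x.1).map fun i => (i, x.2)

/-- Inclusion of the first `k` generators into all generators. -/
def ofFinLetter {k : ℕ} (x : Fin k × Bool) : ℕ × Bool := (encode x.1, x.2)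

theorem toFinLetter_ofFinLetter {k : ℕ} (x : Fin k × Bool) :
    toFinLetter k (ofFinLetter x) = some x := by
  simp [toFinLetter, ofFinLetter]

theorem filterMap_toFinLetter_map {k : ℕ} (L : List (Fin k × Bool)) :
    (L.map ofFinLetter).filterMap (toFinLetter k) = L := by
  simp [List.filterMap_map, toFinLetter_ofFinLetter]

theorem encode_map_ofFinLetter {k : ℕ} (L : List (Fin k × Bool)) :
    encode (L.map ofFinLetter) = encode L := by
  induction L with
  | nil => rfl
  | cons x L ih =>
    rw [List.map_cons, encode_list_cons, encode_list_cons, ih]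
    rfl

theorem toFinLetter_of_le {k : ℕ} {x : ℕ × Bool} (h : k ≤ x.1) : toFinLetter k x = none := by
  have hd : decode (α := Fin k) x.1 = none := by
    simp [Encodable.decode, Encodable.decodeSubtype, h]
  simp [toFinLetter, hd]

theorem primrec_toFinLetter (k : ℕ) : Primrec (toFinLetter k) :=
  Primrec.option_map (Primrec.decode.comp Primrec.fst)
    (Primrec.snd.pair (Primrec.snd.comp Primrec.fst))

theorem primrec_ofFinLetter (k : ℕ) : Primrec (ofFinLetter (k := k)) :=
  (Primrec.encode.comp Primrec.fst).pair Primrec.snd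

theorem primrec_freeGroup_reduce {α : Type*} [Primcodable α] [DecidableEq α] :
    Primrec (FreeGroup.reduce (α := α)) := by
  refine (Primrec.list_foldr (h := fun _ p => List.casesOn p.2 [p.1] fun y t =>
    if p.1.1 = y.1 ∧ p.1.2 = not y.2 then t else p.1 :: y :: t) Primrec.id (Primrec.const [])
    ?_).of_eq fun L => ?_
  · have hx : Primrec fun q : (List (α × Bool) × ((α × Bool) × List (α × Bool))) ×
        ((α × Bool) × List (α × Bool)) => q.1.2.1 :=
      Primrec.fst.comp (Primrec.snd.comp Primrec.fst)
    have hy : Primrec fun q : (List (α × Bool) × ((α × Bool) × List (α × Bool))) ×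
        ((α × Bool) × List (α × Bool)) => q.2.1 := Primrec.fst.comp Primrec.snd
    have ht : Primrec fun q : (List (α × Bool) × ((α × Bool) × List (α × Bool))) ×
        ((α × Bool) × List (α × Bool)) => q.2.2 := Primrec.snd.comp Primrec.snd
    refine Primrec.list_casesOn (h := fun (a : List (α × Bool) × ((α × Bool) × List (α × Bool)))
      (b : (α × Bool) × List (α × Bool)) => if a.2.1.1 = b.1.1 ∧ a.2.1.2 = not b.1.2 then b.2
        else a.2.1 :: b.1 :: b.2) (Primrec.snd.comp Primrec.snd)
      (Primrec.list_cons.comp (Primrec.fst.comp Primrec.snd) (Primrec.const [])) ?_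
    exact Primrec.ite ((Primrec.eq.comp (Primrec.fst.comp hx) (Primrec.fst.comp hy)).and
      (Primrec.eq.comp (Primrec.snd.comp hx) (Primrec.not.comp (Primrec.snd.comp hy)))) ht
      (Primrec.list_cons.comp hx (Primrec.list_cons.comp hy ht))
  · induction L with
    | nil => rfl
    | cons x L ih => simpa using! congrArg _ ih

/-- The words over all generators that may be inserted without changing the element of the
presented group `⟨x₁,…,x_k ∣ relSet k e⟩`, letters outside the first `k` generators being ignored. -/
def IsInsertable (k e : ℕ) (B : List (ℕ × Bool)) : Prop :=
  B = [] ∨ (∃ c : ℕ × Bool, B = [c, (c.1, !c.2)]) ∨ (∃ c : ℕ × Bool, k ≤ c.1 ∧ B = [c]) ∨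
    (FreeGroup.reduce B = B ∧ ∀ x ∈ B, x.1 < k) ∧ encode B ∈ W e

/-- `L'` is obtained from `L` by inserting a word representing the identity. -/
def Insertion (k e : ℕ) (L L' : List (ℕ × Bool)) : Prop :=
  ∃ w : List (ℕ × Bool) × List (ℕ × Bool) × List (ℕ × Bool),
    (L = w.1 ++ w.2.2 ∧ L' = w.1 ++ w.2.1 ++ w.2.2) ∧ IsInsertable k e w.2.1

theorem primrecProj_isInsertable :
    PrimrecProj fun p : (ℕ × ℕ) × List (ℕ × Bool) => IsInsertable p.1.1 p.1.2 p.2 := by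
  have hB : Primrec fun q : ((ℕ × ℕ) × List (ℕ × Bool)) × (ℕ × Bool) => q.1.2 :=
    Primrec.snd.comp Primrec.fst
  have hc : Primrec fun q : ((ℕ × ℕ) × List (ℕ × Bool)) × (ℕ × Bool) => q.2 := Primrec.snd
  refine .or (.of_primrecPred ?_) (.or (.exists_mem (.of_primrecPred ?_))
    (.or (.exists_mem (.of_primrecPred ?_)) (.and (.of_primrecPred ?_) ?_)))
  · exact Primrec.eq.comp Primrec.snd (Primrec.const [])
  · exact Primrec.eq.comp hB (Primrec.list_cons.comp hc (Primrec.list_cons.comp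
      ((Primrec.fst.comp hc).pair (Primrec.not.comp (Primrec.snd.comp hc))) (Primrec.const [])))
  · exact (Primrec.nat_le.comp (Primrec.fst.comp (Primrec.fst.comp Primrec.fst))
      (Primrec.fst.comp hc)).and
        (Primrec.eq.comp hB (Primrec.list_cons.comp hc (Primrec.const [])))
  · have hlt : PrimrecRel fun (x : ℕ × Bool) (k : ℕ) => x.1 < k :=
      Primrec.nat_lt.comp (Primrec.fst.comp Primrec.fst) Primrec.snd
    exact (Primrec.eq.comp (primrec_freeGroup_reduce.comp Primrec.snd) Primrec.snd).and
      (hlt.forall_mem_list.comp Primrec.snd (Primrec.fst.comp Primrec.fst))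
  · exact primrecProj_W.comp
      ((Primrec.snd.comp Primrec.fst).pair (Primrec.encode.comp Primrec.snd))

theorem primrecProj_insertion :
    PrimrecProj fun p : (ℕ × ℕ) × List (ℕ × Bool) × List (ℕ × Bool) =>
      Insertion p.1.1 p.1.2 p.2.1 p.2.2 := by
  have hA := Primrec.fst.comp (Primrec.snd (α := (ℕ × ℕ) × List (ℕ × Bool) × List (ℕ × Bool))
    (β := List (ℕ × Bool) × List (ℕ × Bool) × List (ℕ × Bool)))
  have hBC := Primrec.snd.comp (Primrec.snd (α := (ℕ × ℕ) × List (ℕ × Bool) × List (ℕ × Bool))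
    (β := List (ℕ × Bool) × List (ℕ × Bool) × List (ℕ × Bool)))
  have hB := Primrec.fst.comp hBC
  have hC := Primrec.snd.comp hBC
  refine .exists_mem (.and (.and (.of_primrecPred ?_) (.of_primrecPred ?_)) ?_)
  · exact Primrec.eq.comp (Primrec.fst.comp (Primrec.snd.comp Primrec.fst))
      (Primrec.list_append.comp hA hC)
  · exact Primrec.eq.comp (Primrec.snd.comp (Primrec.snd.comp Primrec.fst))
      (Primrec.list_append.comp (Primrec.list_append.comp hA hB) hC)
  · exact primrecProj_isInsertable.comp ((Primrec.fst.comp Primrec.fst).pair hB)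

/-- The value in the presented group of a word over all generators, letters outside the first `k`
generators being ignored. -/
def wordValue (k e : ℕ) (L : List (ℕ × Bool)) : PresentedGroup (relSet k e) :=
  PresentedGroup.mk _ (FreeGroup.mk (L.filterMap (toFinLetter k)))

theorem wordValue_append (k e : ℕ) (L L' : List (ℕ × Bool)) :
    wordValue k e (L ++ L') = wordValue k e L * wordValue k e L' := by
  simp only [wordValue, List.filterMap_append, ← FreeGroup.mul_mk, map_mul]

theorem IsInsertable.wordValue_eq_one {k e : ℕ} {B : List (ℕ × Bool)} (h : IsInsertable k e B) :
    wordValue k e B = 1 := by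
  rcases h with rfl | ⟨c, rfl⟩ | ⟨c, hc, rfl⟩ | ⟨⟨hred, hlt⟩, hW⟩
  · exact map_one _
  · rcases lt_or_ge c.1 k with hk | hk
    · have h1 : toFinLetter k c = some (⟨c.1, hk⟩, c.2) := toFinLetter_ofFinLetter (⟨c.1, hk⟩, c.2)
      have h2 : toFinLetter k (c.1, !c.2) = some (⟨c.1, hk⟩, !c.2) :=
        toFinLetter_ofFinLetter (⟨c.1, hk⟩, !c.2)
      have h3 : FreeGroup.mk [((⟨c.1, hk⟩ : Fin k), c.2), (⟨c.1, hk⟩, !c.2)] = 1 :=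
        Quot.sound (FreeGroup.Red.Step.cons_not)
      simp [wordValue, h1, h2, h3]
    · have h2 : toFinLetter k (c.1, !c.2) = none := toFinLetter_of_le hk
      simp only [wordValue, List.filterMap_cons, toFinLetter_of_le hk, h2, List.filterMap_nil]
      exact map_one _
  · simp only [wordValue, List.filterMap_cons, toFinLetter_of_le hc, List.filterMap_nil]
    exact map_one _
  · obtain ⟨u, rfl⟩ : ∃ u : List (Fin k × Bool), u.map ofFinLetter = B :=
      ⟨B.pmap (fun x h => (⟨x.1, h⟩, x.2)) hlt, by
        rw [List.map_pmap]; exact List.pmap_eq_self.2 fun x hx => rfl⟩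
    rw [wordValue, filterMap_toFinLetter_map]
    refine (QuotientGroup.eq_one_iff _).2 (Subgroup.subset_normalClosure ?_)
    have hu : FreeGroup.reduce u = u := by
      have h1 := FreeGroup.IsReduced.of_reduce_eq hred
      refine FreeGroup.IsReduced.reduce_eq ?_
      exact ((List.isChain_map _).1 h1).imp fun a b hab h' => hab (by rw [ofFinLetter, h']; rfl)
    rwa [relSet, Set.mem_ofPred_eq, encodeFG, FreeGroup.toWord_mk, hu, ← encode_map_ofFinLetter]

theorem wordValue_eq_of_eqvGen {k e : ℕ} {L L' : List (ℕ × Bool)}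
    (h : Relation.EqvGen (Insertion k e) L L') : wordValue k e L = wordValue k e L' := by
  induction h with
  | rel L L' h =>
    obtain ⟨⟨A, B, C⟩, ⟨rfl, rfl⟩, hB⟩ := h
    simp [wordValue_append, hB.wordValue_eq_one]
  | refl L => rfl
  | symm _ _ _ ih => exact ih.symm
  | trans _ _ _ _ _ ih₁ ih₂ => exact ih₁.trans ih₂

section Converse

variable {k e : ℕ}

local infix:50 "≋" => Relation.EqvGen (Insertion k e)

theorem eqvGen_insertion_append {L L' M M' : List (ℕ × Bool)} (h : L ≋ L') (h' : M ≋ M') :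
    L ++ M ≋ L' ++ M' := by
  refine .trans _ (L' ++ M) _ ?_ ?_
  · induction h with
    | rel _ _ h =>
      obtain ⟨⟨A, B, C⟩, ⟨rfl, rfl⟩, hB⟩ := h
      exact .rel _ _ ⟨(A, B, C ++ M), by simp, hB⟩
    | refl _ => exact .refl _
    | symm _ _ _ ih => exact .symm _ _ ih
    | trans _ _ _ _ _ ih₁ ih₂ => exact .trans _ _ _ ih₁ ih₂
  · induction h' with
    | rel _ _ h =>
      obtain ⟨⟨A, B, C⟩, ⟨rfl, rfl⟩, hB⟩ := h
      exact .rel _ _ ⟨(L' ++ A, B, C), by simp, hB⟩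
    | refl _ => exact .refl _
    | symm _ _ _ ih => exact .symm _ _ ih
    | trans _ _ _ _ _ ih₁ ih₂ => exact .trans _ _ _ ih₁ ih₂

theorem IsInsertable.eqvGen_nil {B : List (ℕ × Bool)} (h : IsInsertable k e B) : B ≋ [] :=
  .symm _ _ (.rel _ _ ⟨([], B, []), by simp, h⟩)

theorem eqvGen_insertion_append_invRev (L : List (ℕ × Bool)) : L ++ invRev L ≋ [] := by
  induction L with
  | nil => exact .refl _
  | cons c L ih =>
    have h1 : [c] ++ (L ++ invRev L) ++ invRev [c] ≋ [c] ++ [] ++ invRev [c] :=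
      eqvGen_insertion_append (eqvGen_insertion_append (.refl _) ih) (.refl _)
    have h2 : [c] ++ [] ++ invRev [c] ≋ [] :=
      IsInsertable.eqvGen_nil (.inr (.inl ⟨c, by simp [invRev]⟩))
    rw [FreeGroup.invRev_cons]
    simpa using Relation.EqvGen.trans _ _ _ h1 h2

theorem eqvGen_insertion_invRev_append (L : List (ℕ × Bool)) : invRev L ++ L ≋ [] := by
  simpa using eqvGen_insertion_append_invRev (k := k) (e := e) (invRev L)

theorem eqvGen_insertion_of_mk_eq {u v : List (Fin k × Bool)} (h : FreeGroup.mk u = FreeGroup.mk v) :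
    u.map ofFinLetter ≋ v.map ofFinLetter := by
  have h' := Quot.eqvGen_exact h
  clear h
  induction h' with
  | rel _ _ h =>
    obtain @⟨A, C, x, b⟩ := h
    refine .symm _ _ (.rel _ _ ⟨(A.map ofFinLetter, [ofFinLetter (x, b), ofFinLetter (x, !b)],
      C.map ofFinLetter), by simp, .inr (.inl ⟨_, rfl⟩)⟩)
  | refl _ => exact .refl _
  | symm _ _ _ ih => exact .symm _ _ ih
  | trans _ _ _ _ _ ih₁ ih₂ => exact .trans _ _ _ ih₁ ih₂

theorem map_invRev_ofFinLetter (u : List (Fin k × Bool)) :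
    (invRev u).map ofFinLetter = invRev (u.map ofFinLetter) := by
  simp [invRev, ofFinLetter, Function.comp_def]

theorem eqvGen_insertion_toWord_of_mem_normalClosure {g : FreeGroup (Fin k)}
    (hg : g ∈ Subgroup.normalClosure (relSet k e)) : g.toWord.map ofFinLetter ≋ [] := by
  induction hg using Subgroup.closure_induction with
  | mem x hx =>
    obtain ⟨r, hr, hc⟩ := Group.mem_conjugatesOfSet_iff.1 hx
    obtain ⟨c, rfl⟩ := isConj_iff.1 hc
    have h1 : (c * r * c⁻¹).toWord.map ofFinLetter ≋
        (c.toWord ++ r.toWord ++ invRev c.toWord).map ofFinLetter :=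
      eqvGen_insertion_of_mk_eq (by
        simp only [FreeGroup.mk_toWord, ← FreeGroup.mul_mk, ← FreeGroup.inv_mk])
    have h2 : r.toWord.map ofFinLetter ≋ [] := by
      refine IsInsertable.eqvGen_nil (.inr (.inr (.inr ⟨⟨?_, ?_⟩, ?_⟩)))
      · refine FreeGroup.IsReduced.reduce_eq ((List.isChain_map _).2 ?_)
        refine (FreeGroup.isReduced_toWord (x := r)).imp fun a b hab h' => hab ?_
        exact Fin.ext h'
      · intro x hx
        obtain ⟨y, -, rfl⟩ := List.mem_map.1 hx
        exact y.1.2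
      · rw [encode_map_ofFinLetter]
        exact hr
    refine .trans _ _ _ h1 ?_
    rw [List.map_append, List.map_append, map_invRev_ofFinLetter]
    refine .trans _ _ _ (eqvGen_insertion_append (eqvGen_insertion_append (.refl _) h2) (.refl _)) ?_
    simpa using eqvGen_insertion_append_invRev _
  | one => exact .refl _
  | mul x y _ _ ihx ihy =>
    have h1 : (x * y).toWord.map ofFinLetter ≋ (x.toWord ++ y.toWord).map ofFinLetter :=
      eqvGen_insertion_of_mk_eq (by simp only [FreeGroup.mk_toWord, ← FreeGroup.mul_mk])
    refine .trans _ _ _ h1 ?_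
    rw [List.map_append]
    exact eqvGen_insertion_append ihx ihy
  | inv x _ ih =>
    rw [FreeGroup.toWord_inv, map_invRev_ofFinLetter]
    have h1 := eqvGen_insertion_append (.refl (invRev (x.toWord.map ofFinLetter))) ih
    rw [List.append_nil] at h1
    exact .trans _ _ _ (.symm _ _ h1) (eqvGen_insertion_invRev_append _)

theorem eqvGen_insertion_map_filterMap (L : List (ℕ × Bool)) :
    L ≋ (L.filterMap (toFinLetter k)).map ofFinLetter := by
  induction L with
  | nil => exact .refl _
  | cons c L ih =>
    rcases lt_or_ge c.1 k with hk | hk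
    · have h1 : toFinLetter k c = some (⟨c.1, hk⟩, c.2) := toFinLetter_ofFinLetter (⟨c.1, hk⟩, c.2)
      rw [List.filterMap_cons_some h1, List.map_cons]
      exact eqvGen_insertion_append (.refl [c]) ih
    · rw [List.filterMap_cons_none (toFinLetter_of_le hk)]
      exact eqvGen_insertion_append (L := [c]) (L' := [])
        (IsInsertable.eqvGen_nil (.inr (.inr (.inl ⟨c, hk, rfl⟩)))) ih

theorem eqvGen_insertion_iff {L L' : List (ℕ × Bool)} :
    L ≋ L' ↔ wordValue k e L = wordValue k e L' := by
  refine ⟨wordValue_eq_of_eqvGen, fun h => ?_⟩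
  refine .trans _ _ _ (eqvGen_insertion_map_filterMap L)
    (.trans _ _ _ ?_ (.symm _ _ (eqvGen_insertion_map_filterMap L')))
  set u := L.filterMap (toFinLetter k)
  set v := L'.filterMap (toFinLetter k)
  have h1 : (invRev u ++ v).map ofFinLetter ≋ [] := by
    refine .trans _ _ _ (eqvGen_insertion_of_mk_eq FreeGroup.mk_toWord.symm)
      (eqvGen_insertion_toWord_of_mem_normalClosure ?_)
    rw [← FreeGroup.mul_mk, ← FreeGroup.inv_mk]
    exact QuotientGroup.eq.1 h
  rw [List.map_append, map_invRev_ofFinLetter] at h1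
  have h2 := eqvGen_insertion_append (.refl (u.map ofFinLetter)) h1
  have h3 := eqvGen_insertion_append
    (eqvGen_insertion_append_invRev (k := k) (e := e) (u.map ofFinLetter)) (.refl (v.map ofFinLetter))
  rw [List.append_nil] at h2
  rw [List.append_assoc] at h3
  exact .symm _ _ (.trans _ _ _ (.symm _ _ h3) h2)

end Converse

theorem ComputableReduction.trans {E F G : ℕ → ℕ → Prop} (h : ComputableReduction E F)
    (h' : ComputableReduction F G) : ComputableReduction E G := by
  obtain ⟨Φ, hΦ, h⟩ := h
  obtain ⟨Ψ, hΨ, h'⟩ := h'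
  exact ⟨Ψ ∘ Φ, hΨ.comp hΦ, fun m n => (h m n).trans (h' _ _)⟩

theorem CeerEquiv.symm {E F : ℕ → ℕ → Prop} (h : CeerEquiv E F) : CeerEquiv F E := ⟨h.2, h.1⟩

theorem CeerEquiv.trans {E F G : ℕ → ℕ → Prop} (h : CeerEquiv E F) (h' : CeerEquiv F G) :
    CeerEquiv E G := ⟨h.1.trans h'.1, h'.2.trans h.2⟩

/-- The word over all generators with code `m`, non-codes being read as the empty word. -/
def codedWord (m : ℕ) : List (ℕ × Bool) := (decode (α := List (ℕ × Bool)) m).getD []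

theorem codedWord_encode (L : List (ℕ × Bool)) : codedWord (encode L) = L := by
  simp [codedWord]

theorem primrec_codedWord : Primrec codedWord :=
  Primrec.option_getD.comp Primrec.decode (Primrec.const [])

theorem exists_index_insertion : ∃ h : ℕ → ℕ, Primrec h ∧ ∀ p m n, Nat.pair m n ∈ W (h p) ↔
    Insertion p.unpair.1 p.unpair.2 (codedWord m) (codedWord n) := by
  obtain ⟨h, hh, H⟩ := PrimrecProj.exists_index (P := fun p a => Insertion p.unpair.1 p.unpair.2
    (codedWord a.unpair.1) (codedWord a.unpair.2)) (by
      have ha : Primrec fun q : ℕ × ℕ => q.2.unpair := Primrec.unpair.comp Primrec.snd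
      exact primrecProj_insertion.comp ((Primrec.unpair.comp Primrec.fst).pair
        ((primrec_codedWord.comp (Primrec.fst.comp ha)).pair
          (primrec_codedWord.comp (Primrec.snd.comp ha)))))
  exact ⟨h, hh, fun p m n => by simp [H]⟩

theorem eqvGen_comp_codedWord_iff {r : List (ℕ × Bool) → List (ℕ × Bool) → Prop}
    (hr : ∀ L, r L L) {m n : ℕ} :
    Relation.EqvGen (fun m n => r (codedWord m) (codedWord n)) m n ↔
      Relation.EqvGen r (codedWord m) (codedWord n) := by
  constructor
  · intro h
    induction h with
    | rel _ _ h => exact .rel _ _ h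
    | refl _ => exact .refl _
    | symm _ _ _ ih => exact .symm _ _ ih
    | trans _ _ _ _ _ ih₁ ih₂ => exact .trans _ _ _ ih₁ ih₂
  · intro h
    generalize hL : codedWord m = L at h
    generalize hL' : codedWord n = L' at h
    induction h generalizing m n with
    | rel _ _ h => exact .rel _ _ (by rwa [hL, hL'])
    | refl _ => exact .rel _ _ (by rw [hL, hL']; exact hr _)
    | symm _ _ _ ih => exact .symm _ _ (ih hL' hL)
    | trans _ L _ _ _ ih₁ ih₂ =>
      exact .trans _ (encode L) _ (ih₁ hL (codedWord_encode L)) (ih₂ (codedWord_encode L) hL')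

theorem insertion_refl (k e : ℕ) (L : List (ℕ × Bool)) : Insertion k e L L :=
  ⟨([], [], L), by simp, .inl rfl⟩

theorem decodeWord_encode {k : ℕ} (u : List (Fin k × Bool)) :
    decodeWord k (encode u) = FreeGroup.mk u := by
  unfold decodeWord
  rw [encodek, Option.getD_some]

/-- The word problems of finitely generated recursively presented groups are uniformly equivalent
to ceers. -/
theorem exists_index_wordProblem : ∃ h : ℕ → ℕ, Primrec h ∧
    ∀ p, CeerEquiv (ceer (h p)) (wordProblem p.unpair.1 (relSet p.unpair.1 p.unpair.2)) := by
  obtain ⟨h, hh, H⟩ := exists_index_insertion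
  refine ⟨h, hh, fun p => ?_⟩
  have key : ∀ m n, ceer (h p) m n ↔ wordValue p.unpair.1 p.unpair.2 (codedWord m) =
      wordValue p.unpair.1 p.unpair.2 (codedWord n) := fun m n => by
    rw [← eqvGen_insertion_iff, ← eqvGen_comp_codedWord_iff (insertion_refl _ _)]
    simp only [ceer, H]
  generalize p.unpair.1 = k at key ⊢
  constructor
  · refine ⟨fun m => encode ((codedWord m).filterMap (toFinLetter k)), ?_, fun m n => ?_⟩
    · have h1 : Primrec fun m => (codedWord m).filterMap (toFinLetter k) :=
        Primrec.listFilterMap primrec_codedWord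
          ((primrec_toFinLetter k).comp Primrec.snd :
            Primrec fun q : ℕ × (ℕ × Bool) => toFinLetter k q.2)
      exact (Primrec.encode.comp h1).to_comp
    · rw [key, wordProblem, decodeWord_encode, decodeWord_encode]
      rfl
  · refine ⟨fun m => encode (((decode (α := List (Fin k × Bool)) m).getD []).map ofFinLetter),
      ?_, fun m n => ?_⟩
    · have h1 : Primrec fun m => ((decode (α := List (Fin k × Bool)) m).getD []).map ofFinLetter :=
        Primrec.list_map (Primrec.option_getD.comp Primrec.decode (Primrec.const []))
          ((primrec_ofFinLetter k).comp Primrec.snd :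
            Primrec fun q : ℕ × (Fin k × Bool) => ofFinLetter q.2)
      exact (Primrec.encode.comp h1).to_comp
    · rw [key, codedWord_encode, codedWord_encode, wordValue, wordValue, filterMap_toFinLetter_map,
        filterMap_toFinLetter_map]
      rfl

theorem isSigma03_fgWordProblemIndices : IsSigma03 FGWordProblemIndices := by
  obtain ⟨h, hh, H⟩ := exists_index_wordProblem
  convert isSigma03_ceerEquiv_range hh using 1
  ext i
  constructor
  · rintro ⟨k, e, hi⟩
    have h' := H (Nat.pair k e)
    rw [Nat.unpair_pair] at h'
    exact ⟨_, hi.trans h'.symm⟩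
  · rintro ⟨p, hp⟩
    exact ⟨_, _, hp.trans (H p)⟩

/-- The equivalence relation on `ℕ` whose only nontrivial class is the set of doubles of elements
of `X`. -/
def collapse (X : ℕ → Prop) (a b : ℕ) : Prop := a = b ∨ ∃ p q, (X p ∧ X q) ∧ a = 2 * p ∧ b = 2 * q

theorem exists_index_collapse {X : ℕ → ℕ → Prop} (hX : PrimrecProj fun p : ℕ × ℕ => X p.1 p.2) :
    ∃ f, Primrec f ∧ ∀ n, ceer (f n) = collapse (X n) := by
  obtain ⟨f, hf, H⟩ := PrimrecProj.exists_index (P := fun n a => ∃ w : ℕ × ℕ,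
      (X n w.1 ∧ X n w.2) ∧ a = Nat.pair (2 * w.1) (2 * w.2)) (by
    have hn : Primrec fun q : (ℕ × ℕ) × ℕ × ℕ => q.1.1 := Primrec.fst.comp Primrec.fst
    have ha : Primrec fun q : (ℕ × ℕ) × ℕ × ℕ => q.1.2 := Primrec.snd.comp Primrec.fst
    have hu : Primrec fun q : (ℕ × ℕ) × ℕ × ℕ => q.2.1 := Primrec.fst.comp Primrec.snd
    have hv : Primrec fun q : (ℕ × ℕ) × ℕ × ℕ => q.2.2 := Primrec.snd.comp Primrec.snd
    refine .exists_mem (.and (.and (hX.comp (hn.pair hu)) (hX.comp (hn.pair hv)))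
      (.of_primrecPred (Primrec.eq.comp ha ?_)))
    exact Primrec₂.natPair.comp (Primrec.nat_mul.comp (Primrec.const 2) hu)
      (Primrec.nat_mul.comp (Primrec.const 2) hv))
  refine ⟨f, hf, fun n => funext fun a => funext fun b => propext ⟨fun h => ?_, ?_⟩⟩
  · induction h with
    | rel a b h =>
      obtain ⟨⟨p, q⟩, hpq, h⟩ := (H _ _).1 h
      exact .inr ⟨p, q, hpq, Nat.pair_eq_pair.1 h⟩
    | refl _ => exact .inl rfl
    | symm _ _ _ ih =>
      rcases ih with rfl | ⟨p, q, hpq, h⟩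
      · exact .inl rfl
      · exact .inr ⟨q, p, hpq.symm, h.symm⟩
    | trans _ _ _ _ _ ih₁ ih₂ =>
      rcases ih₁ with rfl | ⟨p, q, hpq, rfl, rfl⟩
      · exact ih₂
      · rcases ih₂ with rfl | ⟨p', q', hpq', -, rfl⟩
        · exact .inr ⟨p, q, hpq, rfl, rfl⟩
        · exact .inr ⟨p, q', ⟨hpq.1, hpq'.2⟩, rfl, rfl⟩
  · rintro (rfl | ⟨p, q, hpq, rfl, rfl⟩)
    · exact .refl _
    · exact .rel _ _ ((H _ _).2 ⟨(p, q), hpq, rfl⟩)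

theorem collapse_two_mul_iff {X : ℕ → Prop} {p q : ℕ} (hq : X q) :
    collapse X (2 * p) (2 * q) ↔ X p := by
  constructor
  · rintro (h | ⟨p', q', hpq, h, -⟩)
    · rwa [Nat.eq_of_mul_eq_mul_left two_pos h]
    · rw [Nat.eq_of_mul_eq_mul_left two_pos h]
      exact hpq.1
  · exact fun hp => .inr ⟨p, q, ⟨hp, hq⟩, rfl, rfl⟩

theorem ceerEquiv_collapse_eq {X : ℕ → Prop} (hX : ComputablePred X) :
    CeerEquiv (collapse X) (· = ·) := by
  obtain ⟨f, hf, rfl⟩ := ComputablePred.computable_iff.1 hX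
  constructor
  · refine ⟨fun m => bif decide (m % 2 = 0) && f (m / 2) then 0 else m + 1, ?_, fun m n => ?_⟩
    · have h1 : Primrec fun m : ℕ => decide (m % 2 = 0) :=
        Primrec.eq.decide.comp (Primrec.nat_mod.comp Primrec.id (Primrec.const 2)) (Primrec.const 0)
      have h2 : Computable fun m : ℕ => f (m / 2) :=
        hf.comp (Primrec.nat_div.comp Primrec.id (Primrec.const 2)).to_comp
      exact Computable.cond (Primrec.and.to_comp.comp h1.to_comp h2) (Computable.const 0)
        Primrec.succ.to_comp
    · constructor
      · rintro (rfl | ⟨p, q, ⟨hp, hq⟩, rfl, rfl⟩)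
        · rfl
        · simp_all
      · intro h
        rcases hm : decide (m % 2 = 0) && f (m / 2) <;>
          rcases hn : decide (n % 2 = 0) && f (n / 2) <;> simp only [hm, hn, cond_true, cond_false] at h
        · exact .inl (by omega)
        · omega
        · omega
        · simp only [Bool.and_eq_true, decide_eq_true_eq] at hm hn
          exact .inr ⟨_, _, ⟨hm.2, hn.2⟩, by omega, by omega⟩
  · refine ⟨fun n => 2 * n + 1, ?_, fun m n => ?_⟩
    · exact (Primrec.succ.comp (Primrec.nat_mul.comp (Primrec.const 2) Primrec.id)).to_comp
    · constructor
      · rintro rfl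
        exact .inl rfl
      · rintro (h | ⟨p, q, -, h, -⟩) <;> beta_reduce at h <;> omega

theorem computablePred_of_downwardClosed {T : ℕ → ℕ → Prop}
    (hT : ∀ x i j, i ≤ j → T x j → T x i) {a : ℕ} (ha : ∀ x, a ≤ x → ∀ j, T x j) :
    ComputablePred fun q : ℕ => T q.unpair.1 q.unpair.2 := by
  have hc : ∀ x, ∃ c : ℕ × Bool, ∀ j, T x j ↔ (c.2 || decide (j < c.1)) = true := by
    intro x
    classical
    by_cases h : ∃ j, ¬ T x j
    · refine ⟨(Nat.find h, false), fun j => ?_⟩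
      simp only [Bool.false_or, decide_eq_true_eq]
      refine ⟨fun hj => ?_, fun hj => not_not.1 (Nat.find_min h hj)⟩
      by_contra! hle
      exact Nat.find_spec h (hT _ _ _ hle hj)
    · push Not at h
      exact ⟨(0, true), fun j => by simp [h]⟩
  choose c hc using hc
  refine ComputablePred.computable_iff.2 ⟨fun q => (((List.range a).map c).getD q.unpair.1
    (0, true)).2 || decide (q.unpair.2 < (((List.range a).map c).getD q.unpair.1 (0, true)).1),
    Primrec.to_comp ?_, funext fun q => propext ?_⟩
  · have h1 : Primrec fun q : ℕ => ((List.range a).map c).getD q.unpair.1 (0, true) :=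
      (Primrec.list_getD _).comp (Primrec.const _) (Primrec.fst.comp Primrec.unpair)
    exact Primrec.or.comp (Primrec.snd.comp h1) (Primrec.nat_lt.decide.comp
      (Primrec.snd.comp Primrec.unpair) (Primrec.fst.comp h1))
  · beta_reduce
    rcases lt_or_ge q.unpair.1 a with h | h
    · rw [hc, List.getD_eq_getElem _ _ (by simpa using h)]
      simp
    · rw [List.getD_eq_default _ _ (by simpa using h)]
      simp [ha _ h]

/-- If all columns `{j | T x j}` are proper but contain every number of steps insufficient for a
halting computation of the `x`-th code to halt, then `T` is not computable. -/
theorem not_computablePred_of_halting {T : ℕ → ℕ → Prop} (hT : ∀ x, ∃ j, ¬ T x j)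
    (hhalt : ∀ x j, ((Denumerable.ofNat Code x).eval 0).Dom →
      Code.evaln j (Denumerable.ofNat Code x) 0 = none → T x j) :
    ¬ ComputablePred fun q : ℕ => T q.unpair.1 q.unpair.2 := by
  intro h
  obtain ⟨f, hf, hfT⟩ := ComputablePred.computable_iff.1 h
  have hfT : ∀ x j, T x j ↔ f (Nat.pair x j) = true := fun x j => by
    simpa using congrFun hfT (Nat.pair x j)
  have hdom : ∀ x, ∃ j, j ∈ Nat.rfind fun j => Part.some !(f (Nat.pair x j)) := fun x => by
    obtain ⟨j, hj⟩ := hT x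
    exact Part.dom_iff_mem.1 (Nat.rfind_dom.2 ⟨j, by simpa [hfT] using hj, fun _ => trivial⟩)
  choose g hg using hdom
  have hg' : ∀ x, ¬ T x (g x) := fun x => by
    have := Nat.rfind_spec (hg x)
    rw [hfT]
    simpa using this
  have hgc : Computable g := by
    refine Partrec.of_eq_tot (Partrec.rfind ?_) hg
    exact ((Primrec.not.to_comp).comp (hf.comp (Primrec₂.natPair.to_comp.comp Computable.fst
      Computable.snd))).partrec
  refine ComputablePred.halting_problem 0 (ComputablePred.computable_iff.2
    ⟨fun c => (Code.evaln (g (encode c)) c 0).isSome, ?_, funext fun c => propext ?_⟩)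
  · exact Primrec.option_isSome.to_comp.comp (Code.primrec_evaln.to_comp.comp
      (((hgc.comp Computable.encode).pair Computable.id).pair (Computable.const 0)))
  · constructor
    · intro hd
      by_contra hn
      refine hg' (encode c) (hhalt _ _ ?_ ?_)
      · simpa using hd
      · simpa using hn
    · intro hs
      obtain ⟨v, hv⟩ := Option.isSome_iff_exists.1 hs
      exact Part.dom_iff_mem.2 ⟨v, Code.evaln_sound hv⟩

theorem exists_computablePred_iff_mem {A : Set ℕ} (hA : IsSigma03 A) : ∃ X : ℕ → ℕ → Prop,
    (PrimrecProj fun p : ℕ × ℕ => X p.1 p.2) ∧ ∀ n, n ∈ A ↔ ComputablePred (X n) := by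
  obtain ⟨P, hP, hPA⟩ := isSigma03_iff.1 hA
  let T (n x j : ℕ) : Prop := (∃ x', x' ≤ x ∧ ∀ y < j + 1, P n x' y) ∨
    (∃ s, (Code.evaln s (Denumerable.ofNat Code x) 0).isSome) ∧
      Code.evaln j (Denumerable.ofNat Code x) 0 = none
  have hanti : ∀ n x i j, i ≤ j → T n x j → T n x i := by
    rintro n x i j hij (⟨x', hx', h⟩ | ⟨hs, hj⟩)
    · exact .inl ⟨x', hx', fun y hy => h y (by omega)⟩
    · refine .inr ⟨hs, Option.eq_none_iff_forall_not_mem.2 fun v hv => ?_⟩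
      have := Code.evaln_mono hij hv
      simp [hj] at this
  refine ⟨fun n q => T n q.unpair.1 q.unpair.2, ?_, fun n => ⟨fun hn => ?_, fun h => ?_⟩⟩
  · have hx : Primrec fun p : ℕ × ℕ => p.2.unpair.1 :=
      Primrec.fst.comp (Primrec.unpair.comp Primrec.snd)
    have hj : Primrec fun p : ℕ × ℕ => p.2.unpair.2 :=
      Primrec.snd.comp (Primrec.unpair.comp Primrec.snd)
    refine .or (.exists_mem (.and (.of_primrecPred ?_) (.forall_lt ?_ ?_)))
      (.and (.exists_mem (.of_primrecPred (primrecPred_isSome ?_))) (.of_primrecPred ?_))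
    · exact Primrec.nat_le.comp Primrec.snd (hx.comp Primrec.fst)
    · exact hP.comp (f := fun q : ((ℕ × ℕ) × ℕ) × ℕ => (q.1.1.1, q.1.2, q.2))
        ((Primrec.fst.comp (Primrec.fst.comp Primrec.fst)).pair
          ((Primrec.snd.comp Primrec.fst).pair Primrec.snd))
    · exact Primrec.succ.comp (hj.comp Primrec.fst)
    · exact primrec_evaln_ofNat.comp
        ((Primrec.snd.pair (hx.comp Primrec.fst)).pair (Primrec.const 0))
    · exact Primrec.eq.comp (primrec_evaln_ofNat.comp ((hj.pair hx).pair (Primrec.const 0)))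
        (Primrec.const none)
  · obtain ⟨a, ha⟩ := (hPA n).1 hn
    exact computablePred_of_downwardClosed (hanti n) fun x hx j => .inl ⟨a, hx, fun y _ => ha y⟩
  · by_contra hn
    refine not_computablePred_of_halting (T := T n) (fun x => ?_) (fun x j hd hj => ?_) h
    · have hb : ∀ x', ∃ y, ¬ P n x' y := fun x' => by
        by_contra! hc
        exact hn ((hPA n).2 ⟨x', hc⟩)
      choose b hb using hb
      obtain ⟨s, hs⟩ : ∃ s, (∃ t, (Code.evaln t (Denumerable.ofNat Code x) 0).isSome) →
          (Code.evaln s (Denumerable.ofNat Code x) 0).isSome := by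
        by_cases ht : ∃ t, (Code.evaln t (Denumerable.ofNat Code x) 0).isSome
        · exact ht.imp fun t ht _ => ht
        · exact ⟨0, fun h => absurd h ht⟩
      refine ⟨max s ((Finset.range (x + 1)).sup b), ?_⟩
      rintro (⟨x', hx', h⟩ | ⟨ht, hnone⟩)
      · refine hb x' (h _ ?_)
        have : b x' ≤ (Finset.range (x + 1)).sup b :=
          Finset.le_sup (Finset.mem_range.2 (Nat.lt_succ_of_le hx'))
        omega
      · obtain ⟨v, hv⟩ := Option.isSome_iff_exists.1 (hs ht)
        have := Code.evaln_mono (le_max_left s ((Finset.range (x + 1)).sup b)) hv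
        simp [hnone] at this
    · obtain ⟨v, hv⟩ := Part.dom_iff_mem.1 hd
      obtain ⟨s, hs⟩ := Code.evaln_complete.1 hv
      exact .inr ⟨⟨s, Option.isSome_iff_exists.2 ⟨v, hs⟩⟩, hj⟩

theorem exists_ceerEquiv_eq_wordProblem : ∃ k e, CeerEquiv (· = ·) (wordProblem k (relSet k e)) := by
  obtain ⟨c, hc⟩ := Code.exists_code.1 Nat.Partrec.none
  have hR : relSet 1 (encode c) = ∅ := by
    ext g
    simp [relSet, W, hc]
  refine ⟨1, encode c, ?_⟩
  rw [hR]
  have key : ∀ m n, wordProblem 1 ∅ m n ↔ decodeWord 1 m = decodeWord 1 n := fun m n => by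
    refine ⟨fun h => ?_, fun h => congrArg _ h⟩
    have h' := QuotientGroup.eq.1 h
    rwa [Subgroup.normalClosure_empty, Subgroup.mem_bot, inv_mul_eq_one] at h'
  constructor
  · refine ⟨fun n => encode (List.replicate n ((0 : Fin 1), true)), ?_, fun m n => ?_⟩
    · have h1 : Primrec fun n => (List.range n).map fun _ => ((0 : Fin 1), true) :=
        Primrec.list_map Primrec.list_range (Primrec.const _)
      refine ((Primrec.encode.comp h1).of_eq fun n => ?_).to_comp
      rw [List.map_const', List.length_range]
    · refine ⟨fun h => h ▸ rfl, fun h => ?_⟩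
      rw [key, decodeWord_encode, decodeWord_encode] at h
      simpa [FreeGroup.toWord_mk, FreeGroup.reduce_replicate] using
        congrArg (fun g => g.toWord.length) h
  · refine ⟨fun m => encode (FreeGroup.reduce ((decode (α := List (Fin 1 × Bool)) m).getD [])),
      ?_, fun m n => ?_⟩
    · exact (Primrec.encode.comp (primrec_freeGroup_reduce.comp
        (Primrec.option_getD.comp Primrec.decode (Primrec.const [])))).to_comp
    · beta_reduce
      rw [key, encode_inj]
      exact FreeGroup.toWord_injective.eq_iff.symm

theorem computablePred_of_ceerEquiv_collapse {X : ℕ → Prop} {k : ℕ} {R : Set (FreeGroup (Fin k))}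
    (h : CeerEquiv (collapse X) (wordProblem k R)) : ComputablePred X := by
  obtain ⟨⟨Φ, hΦ, hred⟩, Ψ, hΨ, hred'⟩ := h
  let word (m : ℕ) : List (Fin k × Bool) := (decode (α := List (Fin k × Bool)) m).getD []
  let mul (m n : ℕ) : ℕ := encode (word m ++ word n)
  have hmul : ∀ m n, decodeWord k (mul m n) = decodeWord k m * decodeWord k n := fun m n => by
    simp only [mul, decodeWord_encode, ← FreeGroup.mul_mk]
    rfl
  have hword : Primrec word := Primrec.option_getD.comp Primrec.decode (Primrec.const [])
  have hmulc : ∀ w, Primrec fun m => mul m w := fun w =>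
    Primrec.encode.comp (Primrec.list_append.comp hword (Primrec.const (word w)))
  have hright : ∀ {u v w}, wordProblem k R (mul u w) (mul v w) ↔ wordProblem k R u v :=
    fun {u v w} => by simp [wordProblem, hmul]
  have hleft : ∀ {u v w}, wordProblem k R (mul u v) (mul u w) ↔ wordProblem k R v w :=
    fun {u v w} => by simp [wordProblem, hmul]
  have hne : ¬ wordProblem k R (Φ 1) (Φ 3) := by
    rw [← hred]
    rintro (h | ⟨p, q, -, h, -⟩) <;> omega
  let t (i m : ℕ) : ℕ := Ψ (mul m (Φ i))
  have hdec : ∀ u v, wordProblem k R u v ↔ t 1 u = t 1 v ∨ t 3 u = t 3 v := by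
    refine fun u v => ⟨fun h => ?_, ?_⟩
    · rcases (hred' _ _).1 (hright (w := Φ 1).2 h) with h1 | ⟨p, q, hpq, hp, -⟩
      · exact .inl h1
      rcases (hred' _ _).1 (hright (w := Φ 3).2 h) with h3 | ⟨p', q', hpq', hp', -⟩
      · exact .inr h3
      exact absurd (hleft.1 ((hred' (mul u (Φ 1)) (mul u (Φ 3))).2
        (.inr ⟨p, p', ⟨hpq.1, hpq'.1⟩, hp, hp'⟩))) hne
    · rintro (h | h)
      · exact hright.1 ((hred' _ _).2 (.inl h))
      · exact hright.1 ((hred' _ _).2 (.inl h))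
  have ht : ∀ i, Computable (t i) := fun i => hΨ.comp (hmulc (Φ i)).to_comp
  by_cases hX : ∃ q, X q
  · obtain ⟨q, hq⟩ := hX
    have hΦ2 : Computable fun p => Φ (2 * p) :=
      hΦ.comp (Primrec.nat_mul.comp (Primrec.const 2) Primrec.id).to_comp
    have heq : ∀ i, Computable fun p => decide (t i (Φ (2 * p)) = t i (Φ (2 * q))) := fun i =>
      Primrec.eq.decide.to_comp.comp ((ht i).comp hΦ2) (Computable.const _)
    refine ComputablePred.computable_iff.2 ⟨_, Primrec.or.to_comp.comp (heq 1) (heq 3),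
      funext fun p => propext ?_⟩
    rw [← collapse_two_mul_iff hq, hred, hdec]
    simp
  · push Not at hX
    exact ComputablePred.computable_iff.2 ⟨fun _ => false, Computable.const _,
      funext fun p => by simp [hX]⟩

/-- The set of indices of ceers computably equivalent to the word problem of a finitely
generated recursively presented group is Σ⁰₃-complete. -/
theorem FGWordProblemIndices_Sigma03Complete :
    IsSigma03 FGWordProblemIndices ∧
      ∀ A : Set ℕ, IsSigma03 A → (· ∈ A) ≤₀ (· ∈ FGWordProblemIndices) := by
  refine ⟨isSigma03_fgWordProblemIndices, fun A hA => ?_⟩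
  obtain ⟨X, hX, hXA⟩ := exists_computablePred_iff_mem hA
  obtain ⟨f, hf, hfX⟩ := exists_index_collapse hX
  refine ⟨f, hf.to_comp, fun n => ?_⟩
  beta_reduce
  rw [hXA, FGWordProblemIndices, Set.mem_ofPred_eq, hfX]
  constructor
  · intro h
    obtain ⟨k, e, hke⟩ := exists_ceerEquiv_eq_wordProblem
    exact ⟨k, e, (ceerEquiv_collapse_eq h).trans hke⟩
  · rintro ⟨k, e, h⟩
    exact computablePred_of_ceerEquiv_collapse h
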